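/- Let s ≡ 1 (mod 4) be square-free with s ≥ 13 and gcd(s,6) = 1, and K = Q(√6, √s). Then α = 1² + 1² + 1² + (1+√6)² + ((1+√s)/2)² + (1+(1+√s)/2)² has length exactly 6 in the ring of integers O_K; in particular P(O_K) ≥ 6. -/

import Mathlib

open scoped Classical

noncomputable section

/-- `α` is a sum of `n` squares of elements of `S ⊆ ℝ`. -/
def SumOfSquaresLen (S : Set ℝ) (n : ℕ) (α : ℝ) : Prop :=
  ∃ x : Fin n → ℝ, (∀ i, x i ∈ S) ∧ α = ∑ i, x i ^ 2

/-- The length of `α` as a sum of squares of elements of `S` (∞ if not a sum of squares). -/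
def sqLength (S : Set ℝ) (α : ℝ) : ℕ∞ :=
  sInf {n : ℕ∞ | ∃ k : ℕ, n = (k : ℕ∞) ∧ SumOfSquaresLen S k α}

/-- The Pythagoras number of `S ⊆ ℝ`. -/
def pythagorasNumber (S : Set ℝ) : ℕ∞ :=
  sSup {n : ℕ∞ | ∃ α : ℝ, (∃ k : ℕ, SumOfSquaresLen S k α) ∧ n = sqLength S α}

/-- The biquadratic field `ℚ(√p, √q)` as a subfield of `ℝ`. -/
def biquadField (p q : ℝ) : IntermediateField ℚ ℝ :=
  IntermediateField.adjoin ℚ {Real.sqrt p, Real.sqrt q}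

/-- The ring of integers of `ℚ(√p, √q)`, viewed as a subset of `ℝ`. -/
def ringOfInt (p q : ℝ) : Set ℝ :=
  {x : ℝ | x ∈ biquadField p q ∧ IsIntegral ℤ x}

lemma core2 (a b c d : ℤ) (hab : a + b = 4) (ha : a % 2 = 1) (hc : c % 2 = 0) (hd : d % 2 = 0)
    (h : a^2+b^2+c^2+d^2 = 22) : False := by
  obtain ⟨c', rfl⟩ : ∃ c', c = 2*c' := ⟨c/2, by omega⟩
  obtain ⟨d', rfl⟩ : ∃ d', d = 2*d' := ⟨d/2, by omega⟩
  obtain ⟨k, rfl⟩ : ∃ k, a = 2*k+3 := ⟨(a-3)/2, by omega⟩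
  obtain rfl : b = 1 - 2*k := by omega
  have h1 : 2*(k*(k+1)) + c'^2 + d'^2 = 3 := by nlinarith
  have h2 : 2 ∣ k*(k+1) := (Int.even_mul_succ_self k).two_dvd
  obtain ⟨m, hm⟩ := h2
  rw [hm] at h1
  have h3 : c'^2 % 4 = 0 ∨ c'^2 % 4 = 1 := by
    rcases Int.emod_two_eq_zero_or_one c' with h | h
    · left; obtain ⟨t, rfl⟩ : ∃ t, c' = 2*t := ⟨c'/2, by omega⟩
      ring_nf; omega
    · right; obtain ⟨t, rfl⟩ : ∃ t, c' = 2*t+1 := ⟨c'/2, by omega⟩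
      ring_nf; omega
  have h4 : d'^2 % 4 = 0 ∨ d'^2 % 4 = 1 := by
    rcases Int.emod_two_eq_zero_or_one d' with h | h
    · left; obtain ⟨t, rfl⟩ : ∃ t, d' = 2*t := ⟨d'/2, by omega⟩
      ring_nf; omega
    · right; obtain ⟨t, rfl⟩ : ∃ t, d' = 2*t+1 := ⟨d'/2, by omega⟩
      ring_nf; omega
  omega

lemma tri (x : ℤ) (h : x^2 ≤ 2) : x = -1 ∨ x = 0 ∨ x = 1 := by
  have : -1 ≤ x := by nlinarith
  have : x ≤ 1 := by nlinarith
  omega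

lemma core4 (a b c d p q r t : ℤ) (h : a^2+b^2+c^2+d^2 = 22) (hw : p^2+q^2+r^2+t^2 = 2)
    (hd : a*p+b*q+c*r+d*t = 4) (h1 : a % 2 = p % 2) (h2 : b % 2 = q % 2) (h3 : c % 2 = r % 2)
    (h4 : d % 2 = t % 2) : False := by
  rcases tri p (by nlinarith [sq_nonneg q, sq_nonneg r, sq_nonneg t]) with rfl | rfl | rfl <;>
  rcases tri q (by nlinarith [sq_nonneg r, sq_nonneg t]) with rfl | rfl | rfl <;>
  rcases tri r (by nlinarith [sq_nonneg t]) with rfl | rfl | rfl <;>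
  rcases tri t (by nlinarith) with rfl | rfl | rfl <;>
  first
  | (exfalso; norm_num at hw; done)
  | exact core2 a b c d (by omega) (by omega) (by omega) (by omega) (by linarith)
  | exact core2 a (-b) c d (by omega) (by omega) (by omega) (by omega) (by linarith)
  | exact core2 (-a) b c d (by omega) (by omega) (by omega) (by omega) (by linarith)
  | exact core2 (-a) (-b) c d (by omega) (by omega) (by omega) (by omega) (by linarith)
  | exact core2 a c b d (by omega) (by omega) (by omega) (by omega) (by linarith)
  | exact core2 a (-c) b d (by omega) (by omega) (by omega) (by omega) (by linarith)
  | exact core2 (-a) c b d (by omega) (by omega) (by omega) (by omega) (by linarith)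
  | exact core2 (-a) (-c) b d (by omega) (by omega) (by omega) (by omega) (by linarith)
  | exact core2 a d c b (by omega) (by omega) (by omega) (by omega) (by linarith)
  | exact core2 a (-d) c b (by omega) (by omega) (by omega) (by omega) (by linarith)
  | exact core2 (-a) d c b (by omega) (by omega) (by omega) (by omega) (by linarith)
  | exact core2 (-a) (-d) c b (by omega) (by omega) (by omega) (by omega) (by linarith)
  | exact core2 b c a d (by omega) (by omega) (by omega) (by omega) (by linarith)
  | exact core2 b (-c) a d (by omega) (by omega) (by omega) (by omega) (by linarith)
  | exact core2 (-b) c a d (by omega) (by omega) (by omega) (by omega) (by linarith)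
  | exact core2 (-b) (-c) a d (by omega) (by omega) (by omega) (by omega) (by linarith)
  | exact core2 b d a c (by omega) (by omega) (by omega) (by omega) (by linarith)
  | exact core2 b (-d) a c (by omega) (by omega) (by omega) (by omega) (by linarith)
  | exact core2 (-b) d a c (by omega) (by omega) (by omega) (by omega) (by linarith)
  | exact core2 (-b) (-d) a c (by omega) (by omega) (by omega) (by omega) (by linarith)
  | exact core2 c d a b (by omega) (by omega) (by omega) (by omega) (by linarith)
  | exact core2 c (-d) a b (by omega) (by omega) (by omega) (by omega) (by linarith)
  | exact core2 (-c) d a b (by omega) (by omega) (by omega) (by omega) (by linarith)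
  | exact core2 (-c) (-d) a b (by omega) (by omega) (by omega) (by omega) (by linarith)

/-- five-term core when the square-norm of `v` is one, with the nonzero entry of `v` first -/
lemma core5a (u0 u1 u2 u3 u4 v0 v1 v2 v3 v4 w0 w1 w2 w3 w4 : ℤ) (hv0 : v0 ≠ 0)
    (hU : u0^2+u1^2+u2^2+u3^2+u4^2 = 26) (hV : v0^2+v1^2+v2^2+v3^2+v4^2 = 1)
    (hW : w0^2+w1^2+w2^2+w3^2+w4^2 = 2)
    (huv : u0*v0+u1*v1+u2*v2+u3*v3+u4*v4 = 2) (huw : u0*w0+u1*w1+u2*w2+u3*w3+u4*w4 = 4)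
    (hvw : v0*w0+v1*w1+v2*w2+v3*w3+v4*w4 = 0)
    (h1 : u1 % 2 = w1 % 2) (h2 : u2 % 2 = w2 % 2) (h3 : u3 % 2 = w3 % 2)
    (h4 : u4 % 2 = w4 % 2) : False := by
  have hp : 0 < v0^2 := by positivity
  have n1 := sq_nonneg v1
  have n2 := sq_nonneg v2
  have n3 := sq_nonneg v3
  have n4 := sq_nonneg v4
  have e1 : v1 = 0 := by
    apply pow_eq_zero_iff (two_ne_zero) |>.1; clear huv huw hvw; omega
  have e2 : v2 = 0 := by
    apply pow_eq_zero_iff (two_ne_zero) |>.1; clear huv huw hvw; omega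
  have e3 : v3 = 0 := by
    apply pow_eq_zero_iff (two_ne_zero) |>.1; clear huv huw hvw; omega
  have e4 : v4 = 0 := by
    apply pow_eq_zero_iff (two_ne_zero) |>.1; clear huv huw hvw; omega
  subst e1 e2 e3 e4
  have hv1 : v0^2 = 1 := by linarith
  have ew : w0 = 0 := by
    have : v0 * w0 = 0 := by linarith
    rcases mul_eq_zero.1 this with h | h
    · exact absurd h hv0
    · exact h
  subst ew
  have hu : u0^2 = 4 := by
    have : u0 * v0 = 2 := by linarith
    calc u0^2 = u0^2 * v0^2 := by rw [hv1, mul_one]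
      _ = (u0*v0)^2 := by ring
      _ = 4 := by rw [this]; norm_num
  exact core4 u1 u2 u3 u4 w1 w2 w3 w4 (by linarith) (by linarith) (by linarith) h1 h2 h3 h4

set_option maxHeartbeats 1000000 in
lemma core5 (s : ℤ) (hs : 13 ≤ s) (u v w z : Fin 5 → ℤ)
    (huw : ∀ i, u i % 2 = w i % 2) (hvz : ∀ i, v i % 2 = z i % 2)
    (h1 : ∑ i, (u i^2 + 6 * v i^2 + s * w i^2 + 6 * s * z i^2) = 50 + 2*s)
    (h2 : ∑ i, (u i * v i + s * w i * z i) = 4)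
    (h3 : ∑ i, (u i * w i + 6 * v i * z i) = 4)
    (h4 : ∑ i, (u i * z i + v i * w i) = 0) : False := by
  have hz : ∀ i, z i = 0 := by
    intro i
    by_contra hne
    have hp : 1 ≤ z i ^2 := by have : 0 < z i ^2 := by positivity
                               omega
    have := Finset.single_le_sum (f := fun i => u i^2 + 6 * v i^2 + s * w i^2 + 6 * s * z i^2)
      (fun j _ => by positivity) (Finset.mem_univ i)
    rw [h1] at this
    have : 0 ≤ s * w i^2 := by positivity
    nlinarith [sq_nonneg (u i), sq_nonneg (v i)]
  have hv : ∀ i, ∃ v', v i = 2 * v' := fun i => ⟨v i / 2, by have := hvz i; rw [hz] at this; omega⟩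
  choose y hy using hv
  simp only [hz, hy] at h1 h2 h3 h4
  simp only [Fin.sum_univ_five] at h1 h2 h3 h4
  have p0 := huw 0
  have p1 := huw 1
  have p2 := huw 2
  have p3 := huw 3
  have p4 := huw 4
  generalize u 0 = u0 at *
  generalize u 1 = u1 at *
  generalize u 2 = u2 at *
  generalize u 3 = u3 at *
  generalize u 4 = u4 at *
  generalize w 0 = w0 at *
  generalize w 1 = w1 at *
  generalize w 2 = w2 at *
  generalize w 3 = w3 at *
  generalize w 4 = w4 at *
  generalize y 0 = v0 at *
  generalize y 1 = v1 at *
  generalize y 2 = v2 at *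
  generalize y 3 = v3 at *
  generalize y 4 = v4 at *
  have a2 : u0*v0+u1*v1+u2*v2+u3*v3+u4*v4 = 2 := by linarith
  have a3 : u0*w0+u1*w1+u2*w2+u3*w3+u4*w4 = 4 := by linarith
  have a4 : v0*w0+v1*w1+v2*w2+v3*w3+v4*w4 = 0 := by linarith
  obtain ⟨U, hU⟩ : ∃ U, U = u0^2+u1^2+u2^2+u3^2+u4^2 := ⟨_, rfl⟩
  obtain ⟨V, hV⟩ : ∃ V, V = v0^2+v1^2+v2^2+v3^2+v4^2 := ⟨_, rfl⟩
  obtain ⟨W, hW⟩ : ∃ W, W = w0^2+w1^2+w2^2+w3^2+w4^2 := ⟨_, rfl⟩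
  have a1 : U + 24 * V + s * W = 50 + 2 * s := by rw [hU, hV, hW]; linarith
  have hU0 : 0 ≤ U := by rw [hU]; positivity
  have hV0 : 0 ≤ V := by rw [hV]; positivity
  have hW0 : 0 ≤ W := by rw [hW]; positivity
  have cs : ∀ a0 a1 a2 a3 a4 b0 b1 b2 b3 b4 : ℤ, (a0*b0+a1*b1+a2*b2+a3*b3+a4*b4)^2 ≤
      (a0^2+a1^2+a2^2+a3^2+a4^2) * (b0^2+b1^2+b2^2+b3^2+b4^2) := by
    intro a0 a1 a2 a3 a4 b0 b1 b2 b3 b4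
    have := Finset.sum_mul_sq_le_sq_mul_sq Finset.univ ![a0,a1,a2,a3,a4] ![b0,b1,b2,b3,b4]
    simpa [Fin.sum_univ_five] using this
  have c1 : 4 ≤ U * V := by
    have := cs u0 u1 u2 u3 u4 v0 v1 v2 v3 v4
    rw [a2, ← hU, ← hV] at this; linarith
  have c2 : 16 ≤ U * W := by
    have := cs u0 u1 u2 u3 u4 w0 w1 w2 w3 w4
    rw [a3, ← hU, ← hW] at this; linarith
  have hV1 : 1 ≤ V := by by_contra h; have : V = 0 := by omega
                         rw [this] at c1; omega
  have hW1 : 1 ≤ W := by by_contra h; have : W = 0 := by omega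
                         rw [this] at c2; omega
  have hU1 : 1 ≤ U := by by_contra h; have : U = 0 := by omega
                         rw [this] at c2; omega
  have hW4 : W < 4 := by nlinarith
  have par : ∀ x y : ℤ, x % 2 = y % 2 → (x * y) % 2 = (y^2) % 2 := by
    intro x y h; rw [sq, Int.mul_emod, h, ← Int.mul_emod]
  have hWe : W % 2 = 0 := by
    have := par _ _ p0
    have := par _ _ p1
    have := par _ _ p2
    have := par _ _ p3
    have := par _ _ p4
    omega
  have hW2 : W = 2 := by omega
  rw [hW2] at a1 c2 hW
  have hVV : V = 1 := by omega
  have hU26 : U = 26 := by omega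
  rw [hVV] at hV
  rw [hU26] at hU
  by_cases q0 : v0 = 0
  · by_cases q1 : v1 = 0
    · by_cases q2 : v2 = 0
      · by_cases q3 : v3 = 0
        · by_cases q4 : v4 = 0
          · simp [q0, q1, q2, q3, q4] at hV
          · exact core5a u4 u1 u2 u3 u0 v4 v1 v2 v3 v0 w4 w1 w2 w3 w0 q4 (by linarith only [hU]) (by linarith only [hV]) (by linarith only [hW])
              (by linarith only [a2]) (by linarith only [a3]) (by linarith only [a4]) p1 p2 p3 p0
        · exact core5a u3 u1 u2 u0 u4 v3 v1 v2 v0 v4 w3 w1 w2 w0 w4 q3 (by linarith only [hU]) (by linarith only [hV]) (by linarith only [hW])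
              (by linarith only [a2]) (by linarith only [a3]) (by linarith only [a4]) p1 p2 p0 p4
      · exact core5a u2 u1 u0 u3 u4 v2 v1 v0 v3 v4 w2 w1 w0 w3 w4 q2 (by linarith only [hU]) (by linarith only [hV]) (by linarith only [hW])
              (by linarith only [a2]) (by linarith only [a3]) (by linarith only [a4]) p1 p0 p3 p4
    · exact core5a u1 u0 u2 u3 u4 v1 v0 v2 v3 v4 w1 w0 w2 w3 w4 q1 (by linarith only [hU]) (by linarith only [hV]) (by linarith only [hW])
              (by linarith only [a2]) (by linarith only [a3]) (by linarith only [a4]) p0 p2 p3 p4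
  · exact core5a u0 u1 u2 u3 u4 v0 v1 v2 v3 v4 w0 w1 w2 w3 w4 q0 (by linarith only [hU]) (by linarith only [hV]) (by linarith only [hW])
              (by linarith only [a2]) (by linarith only [a3]) (by linarith only [a4]) p1 p2 p3 p4

lemma isInt_nat {R : Type*} [CommRing R] [Algebra R ℝ] (n : ℕ) : IsIntegral R (n : ℝ) := by
  have := isIntegral_algebraMap (R := R) (A := ℝ) (x := (n : R))
  simpa using this

/-- A polynomial value commutes with sign changes of the two square roots. -/
lemma conj_eval (S : ℚ) (a b c d : ℚ) (f : Polynomial ℤ) : ∃ P Q R T : ℚ, ∀ r e : ℝ, r^2 = 6 → e^2 = S →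
    Polynomial.aeval (a + b*r + c*e + d*(r*e) : ℝ) f = P + Q*r + R*e + T*(r*e) := by
  induction f using Polynomial.induction_on' with
  | add p q hp hq =>
    obtain ⟨P, Q, R, T, h⟩ := hp
    obtain ⟨P', Q', R', T', h'⟩ := hq
    refine ⟨P+P', Q+Q', R+R', T+T', fun r e hr he => ?_⟩
    rw [map_add, h r e hr he, h' r e hr he]; push_cast; ring
  | monomial n m =>
    induction n with
    | zero => exact ⟨m, 0, 0, 0, fun r e hr he => by simp⟩
    | succ n ih =>
      obtain ⟨P, Q, R, T, h⟩ := ih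
      refine ⟨P*a+6*Q*b+S*R*c+6*S*T*d, P*b+Q*a+S*R*d+S*T*c, P*c+R*a+6*Q*d+6*T*b, P*d+Q*c+R*b+T*a,
        fun r e hr he => ?_⟩
      have h0 := h r e hr he
      rw [Polynomial.aeval_monomial] at h0 ⊢
      rw [pow_succ, ← mul_assoc, h0]
      push_cast
      rw [← he]
      linear_combination (Q*b + T*d*e^2 + Q*d*e+T*b*e) * hr

lemma rat_indep (q : ℝ) (hq : Irrational q) (a b : ℚ) (h : (a:ℝ) + b * q = 0) : a = 0 ∧ b = 0 := by
  have hb : b = 0 := by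
    by_contra hb
    have : q = ((-a / b : ℚ) : ℝ) := by
      have : (b:ℝ) ≠ 0 := by exact_mod_cast hb
      push_cast; field_simp; linarith
    exact hq ⟨_, this.symm⟩
  subst hb
  refine ⟨?_, rfl⟩
  simpa using h

lemma indep (r e : ℝ) (S : ℚ) (hr : r^2 = 6) (he : e^2 = S) (ir : Irrational r) (ie : Irrational e)
    (ire : Irrational (r*e)) (P Q R T : ℚ) (h : (P:ℝ) + Q*r+R*e+T*(r*e) = 0) :
    P = 0 ∧ Q = 0 ∧ R = 0 ∧ T = 0 := by
  have key : R^2 - 6*T^2 = 0 := by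
    by_contra hN
    have hN' : ((R^2 - 6*T^2 : ℚ) : ℝ) ≠ 0 := by exact_mod_cast hN
    -- e = p + q r
    obtain ⟨p, q, hpq⟩ : ∃ p q : ℚ, e = p + q * r := by
      refine ⟨-(P*R-6*Q*T)/(R^2-6*T^2), -(Q*R-P*T)/(R^2-6*T^2), ?_⟩
      push_cast at hN' ⊢
      field_simp
      linear_combination (R - T*r) * h + (Q*T + T^2*e) * hr
    have h2 : ((p^2+6*q^2 - S : ℚ):ℝ) + ((2*p*q : ℚ):ℝ) * r = 0 := by
      push_cast
      rw [hpq] at he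
      linear_combination he - q^2*hr
    have h3 := (rat_indep r ir _ _ h2).2
    rcases mul_eq_zero.1 h3 with h | h
    · have hp : p = 0 := by linarith
      apply ire
      refine ⟨6*q, ?_⟩
      rw [hpq, hp]; push_cast; linear_combination (-q:ℝ) * hr
    · apply ie
      exact ⟨p, by rw [hpq, h]; simp⟩
  have hT : T = 0 := by
    by_contra hT
    have hT' : (T:ℝ) ≠ 0 := by exact_mod_cast hT
    have k2 : ((R:ℝ)/T)^2 = r^2 := by
      rw [hr, div_pow, div_eq_iff (by positivity)]
      have : ((R^2 - 6*T^2 : ℚ):ℝ) = 0 := by rw [key]; simp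
      push_cast at this; linarith
    rcases sq_eq_sq_iff_eq_or_eq_neg.1 k2 with h | h
    · exact ir ⟨R/T, by push_cast; exact h⟩
    · exact ir ⟨-(R/T), by push_cast; linarith⟩
  subst hT
  have hR : R = 0 := by simpa using key
  subst hR
  have := rat_indep r ir P Q (by simpa using h)
  exact ⟨this.1, this.2, rfl, rfl⟩

lemma field_form (S : ℕ) (x : ℝ) (hx : x ∈ biquadField 6 S) : ∃ a b c d : ℚ,
    x = a + b*√6 + c*√(S:ℝ) + d*(√6*√(S:ℝ)) := by
  have hr : (√6:ℝ)^2 = 6 := Real.sq_sqrt (by norm_num)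
  have he : (√(S:ℝ))^2 = S := Real.sq_sqrt (by positivity)
  unfold biquadField at hx
  rw [← IntermediateField.mem_toSubalgebra, IntermediateField.adjoin_toSubalgebra_of_isAlgebraic] at hx
  · induction hx using Algebra.adjoin_induction with
    | mem x hx =>
      rcases hx with rfl | rfl
      · exact ⟨0,1,0,0, by simp⟩
      · exact ⟨0,0,1,0, by simp⟩
    | algebraMap q => exact ⟨q,0,0,0, by simp⟩
    | add x y _ _ hx hy =>
      obtain ⟨a,b,c,d,rfl⟩ := hx
      obtain ⟨a',b',c',d',rfl⟩ := hy
      exact ⟨a+a',b+b',c+c',d+d', by push_cast; ring⟩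
    | mul x y _ _ hx hy =>
      obtain ⟨a,b,c,d,rfl⟩ := hx
      obtain ⟨P,Q,R,T,rfl⟩ := hy
      refine ⟨P*a+6*Q*b+S*R*c+6*S*T*d, P*b+Q*a+S*R*d+S*T*c, P*c+R*a+6*Q*d+6*T*b, P*d+Q*c+R*b+T*a, ?_⟩
      push_cast
      linear_combination (Q*b + T*d*√(S:ℝ)^2 + Q*d*√(S:ℝ)+T*b*√(S:ℝ)) * hr +
        (6*T*d + R*c + √6*R*d + √6*T*c) * he
  · have hi : ∀ n : ℕ, IsIntegral ℚ (√(n:ℝ)) := fun n => by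
      apply IsIntegral.of_pow (n := 2) (by norm_num)
      rw [Real.sq_sqrt (by positivity)]
      exact isInt_nat _
    intro x hx
    rcases hx with rfl | rfl
    · exact_mod_cast (hi 6).isAlgebraic
    · exact (hi S).isAlgebraic

lemma isInt_congr {x y : ℝ} (h : IsIntegral ℤ x) (e : y = x) : IsIntegral ℤ y := e ▸ h

lemma rat_int (q : ℚ) (h : IsIntegral ℤ (q:ℝ)) : ∃ n : ℤ, q = n := by
  have : IsIntegral ℤ q := by
    have h' : IsIntegral ℤ (algebraMap ℚ ℝ q) := h
    exact (isIntegral_algebraMap_iff (algebraMap ℚ ℝ).injective).1 h'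
  obtain ⟨n, hn⟩ := IsIntegrallyClosed.isIntegral_iff.1 this
  exact ⟨n, by simpa using hn.symm⟩

/-- all conjugates are integral -/
lemma conj_int (r e : ℝ) (S : ℚ) (hr : r^2 = 6) (he : e^2 = S) (ir : Irrational r) (ie : Irrational e)
    (ire : Irrational (r*e)) (a b c d : ℚ) (h : IsIntegral ℤ (a + b*r + c*e + d*(r*e) : ℝ)) (r' e' : ℝ)
    (hr' : r'^2 = 6) (he' : e'^2 = S) : IsIntegral ℤ (a + b*r' + c*e' + d*(r'*e') : ℝ) := by
  obtain ⟨f, hf, hf0⟩ := h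
  refine ⟨f, hf, ?_⟩
  rw [← Polynomial.aeval_def] at hf0 ⊢
  obtain ⟨P,Q,R,T,H⟩ := conj_eval S a b c d f
  rw [H r e hr he] at hf0
  obtain ⟨rfl, rfl, rfl, rfl⟩ := indep r e S hr he ir ie ire P Q R T hf0
  rw [H r' e' hr' he']; simp

/-- integers of `ℚ(√6)` -/
lemma quad_int (r : ℝ) (hr : r^2 = 6) (A B : ℚ) (h : IsIntegral ℤ (A + B*r : ℝ))
    (h' : IsIntegral ℤ (A - B*r : ℝ)) : ∃ m n : ℤ, A = m ∧ B = n := by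
  have ir : IsIntegral ℤ r := by
    apply IsIntegral.of_pow (n := 2) (by norm_num)
    rw [hr]; exact_mod_cast isIntegral_natCast (a := 6)
  obtain ⟨a, ha⟩ := rat_int (2*A) (by
    have := h.add h'
    refine isInt_congr this ?_; push_cast; ring)
  obtain ⟨b, hb⟩ := rat_int (12*B) (by
    have := (h.sub h').mul ir
    refine isInt_congr this ?_; push_cast; linear_combination (-2*B:ℝ)*hr)
  obtain ⟨k, hk⟩ := rat_int (A^2-6*B^2) (by
    have := h.mul h'
    refine isInt_congr this ?_; push_cast; linear_combination (B^2:ℝ)*hr)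
  have e1 : (6:ℤ)*a^2 - b^2 = 24 * k := by
    have : (6:ℚ)*a^2 - b^2 = 24 * k := by rw [← ha, ← hb, ← hk]; ring
    exact_mod_cast this
  have d6 : (6:ℤ) ∣ b := by
    have : (6:ℤ) ∣ b^2 := ⟨a^2 - 4*k, by linarith⟩
    have d2 : (2:ℤ) ∣ b := Int.prime_two.dvd_of_dvd_pow (dvd_trans (by norm_num) this)
    have d3 : (3:ℤ) ∣ b := Int.prime_three.dvd_of_dvd_pow (dvd_trans (by norm_num) this)
    omega
  obtain ⟨b, rfl⟩ := d6
  have e2 : a^2 = 6*b^2 + 4*k := by linarith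
  have d2 : (2:ℤ) ∣ a := Int.prime_two.dvd_of_dvd_pow (n := 2) ⟨3*b^2+2*k, by linarith⟩
  obtain ⟨a, rfl⟩ := d2
  have d2 : (2:ℤ) ∣ b := by
    apply Int.prime_two.dvd_of_dvd_pow (n := 2)
    have : 2*a^2 = 3*b^2+2*k := by linarith
    omega
  obtain ⟨b, rfl⟩ := d2
  refine ⟨a, b, ?_, ?_⟩ <;> push_cast at * <;> linarith

lemma int_form (r e : ℝ) (s : ℕ) (hr : r^2 = 6) (he : e^2 = s) (ir : Irrational r) (ie : Irrational e)
    (ire : Irrational (r*e)) (hs4 : s % 4 = 1) (hsf : Squarefree s) (h6 : Nat.gcd s 6 = 1)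
    (a b c d : ℚ) (h : IsIntegral ℤ (a + b*r + c*e + d*(r*e) : ℝ)) :
    ∃ u v w z : ℤ, 2*a = u ∧ 2*b = v ∧ 2*c = w ∧ 2*d = z ∧ u % 2 = w % 2 ∧ v % 2 = z % 2 := by
  have H := conj_int r e s hr (by exact_mod_cast he) ir ie ire a b c d h
  have i1 := h
  have i2 := H (-r) e (by simpa using hr) (by exact_mod_cast he)
  have i3 := H r (-e) hr (by simpa using he)
  have i4 := H (-r) (-e) (by simpa using hr) (by simpa using he)
  have inte : IsIntegral ℤ e := by
    apply IsIntegral.of_pow (n := 2) (by norm_num)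
    rw [he]; exact isInt_nat _
  obtain ⟨u, v, hu, hv⟩ := quad_int r hr (2*a) (2*b)
    (by refine isInt_congr (i1.add i3) ?_; push_cast; ring) (by refine isInt_congr (i2.add i4) ?_; push_cast; ring)
  obtain ⟨w, z, hw, hz⟩ := quad_int r hr (2*s*c) (2*s*d)
    (by refine isInt_congr ((i1.sub i3).mul inte) ?_; push_cast; rw [← he]; ring)
    (by refine isInt_congr ((i2.sub i4).mul inte) ?_; push_cast; rw [← he]; ring)
  obtain ⟨k, l, hk, hl⟩ := quad_int r hr (a^2+6*b^2-s*(c^2+6*d^2)) (2*a*b-2*s*c*d)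
    (by refine isInt_congr (i1.mul i3) ?_; push_cast; rw [← he]; linear_combination (d^2*e^2-b^2:ℝ)*hr)
    (by refine isInt_congr (i2.mul i4) ?_; push_cast; rw [← he]; linear_combination (d^2*e^2-b^2:ℝ)*hr)
  have hs0 : (s:ℤ) ≠ 0 := by exact_mod_cast hsf.ne_zero
  have e1 : (s:ℤ)*(u^2+6*v^2) - (w^2+6*z^2) = 4*s*k := by
    have : (s:ℚ)*(u^2+6*v^2) - (w^2+6*z^2) = 4*s*k := by rw [← hu, ← hv, ← hw, ← hz, ← hk]; ring
    exact_mod_cast this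
  have e2 : (s:ℤ)*(u*v) - w*z = 2*s*l := by
    have : (s:ℚ)*(u*v) - w*z = 2*s*l := by rw [← hu, ← hv, ← hw, ← hz, ← hl]; ring
    exact_mod_cast this
  have hsq : Squarefree (s:ℤ) := Int.squarefree_natCast.2 hsf
  have cop : IsCoprime (s:ℤ) 6 := by
    have : IsCoprime (s:ℤ) ((6:ℕ):ℤ) := Nat.isCoprime_iff_coprime.2 h6
    simpa using this
  have dw : (s:ℤ) ∣ w := by
    refine (Squarefree.dvd_pow_iff_dvd (n := 3) hsq (by norm_num)).1 ?_
    exact ⟨w*(u^2+6*v^2-4*k) - 6*z*(u*v-2*l), by linear_combination (-w)*e1 + 6*z*e2⟩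
  have dz : (s:ℤ) ∣ z := by
    refine (hsq.dvd_pow_iff_dvd (n := 2) (by norm_num)).1 ?_
    refine cop.dvd_of_dvd_mul_left ?_
    obtain ⟨w, rfl⟩ := dw
    exact ⟨u^2+6*v^2-4*k - s*w^2, by linear_combination -e1⟩
  obtain ⟨w, rfl⟩ := dw
  obtain ⟨z, rfl⟩ := dz
  have hsQ : (s:ℚ) ≠ 0 := by exact_mod_cast hs0
  refine ⟨u, v, w, z, hu, hv, ?_, ?_, ?_⟩
  · push_cast at hw; apply mul_left_cancel₀ hsQ; linarith
  · push_cast at hz; apply mul_left_cancel₀ hsQ; linarith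
  have e3 : u^2+6*v^2 - s*(w^2+6*z^2) = 4*k := by
    apply mul_left_cancel₀ hs0; linear_combination e1
  obtain ⟨t, ht⟩ : ∃ t : ℤ, (s:ℤ) = 4*t+1 := ⟨s/4, by omega⟩
  rw [ht] at e3
  have e4 : u^2+6*v^2 - w^2-6*z^2 = 4*(k + t*(w^2+6*z^2)) := by linear_combination e3
  generalize k + t*(w^2+6*z^2) = m at e4
  rcases Int.emod_two_eq_zero_or_one u with hu | hu <;>
  rcases Int.emod_two_eq_zero_or_one v with hv | hv <;>
  rcases Int.emod_two_eq_zero_or_one w with hw | hw <;>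
  rcases Int.emod_two_eq_zero_or_one z with hz | hz <;>
  first
  | exact ⟨by omega, by omega⟩
  | (exfalso
     rw [← Int.emod_add_mul_ediv u 2, ← Int.emod_add_mul_ediv v 2, ← Int.emod_add_mul_ediv w 2, ← Int.emod_add_mul_ediv z 2, hu, hv, hw, hz] at e4
     ring_nf at e4
     omega)


lemma sos_succ (S : Set ℝ) (h0 : (0:ℝ) ∈ S) (k : ℕ) (α : ℝ) (h : SumOfSquaresLen S k α) :
    SumOfSquaresLen S (k+1) α := by
  obtain ⟨x, hx, rfl⟩ := h
  refine ⟨Fin.cons 0 x, ?_, ?_⟩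
  · intro i
    refine Fin.cases ?_ (fun j => ?_) i
    · simpa using h0
    · simpa using hx j
  · simp [Fin.sum_univ_succ]

lemma sos_mono (S : Set ℝ) (h0 : (0:ℝ) ∈ S) (k l : ℕ) (hkl : k ≤ l) (α : ℝ)
    (h : SumOfSquaresLen S k α) : SumOfSquaresLen S l α := by
  induction l, hkl using Nat.le_induction with
  | base => exact h
  | succ n _ ih => exact sos_succ S h0 n α ih

lemma irr_sqrt (n : ℕ) (h1 : 2 ≤ n) (h : Squarefree n) : Irrational (√(n:ℝ)) := by
  rw [irrational_sqrt_natCast_iff]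
  rintro ⟨m, hm⟩
  have := h m ⟨1, by rw [hm, mul_one]⟩
  have : m = 1 := by simpa using this
  subst this
  omega

lemma not_five (s : ℕ) (hs4 : s % 4 = 1) (hsf : Squarefree s)
    (hs13 : 13 ≤ s) (h6 : Nat.gcd s 6 = 1) :
    ¬ SumOfSquaresLen (ringOfInt 6 (s : ℝ)) 5
        ((1 : ℝ) ^ 2 + 1 ^ 2 + 1 ^ 2 + (1 + Real.sqrt 6) ^ 2
          + ((1 + Real.sqrt s) / 2) ^ 2 + (1 + (1 + Real.sqrt s) / 2) ^ 2) := by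
  rintro ⟨x, hx, hsum⟩
  have hr : (√6:ℝ)^2 = 6 := Real.sq_sqrt (by norm_num)
  have he : (√(s:ℝ))^2 = s := Real.sq_sqrt (by positivity)
  have sq6 : Squarefree 6 := by
    have h := (Nat.squarefree_mul (m := 2) (n := 3) (by norm_num)).2
      ⟨Nat.prime_two.prime.squarefree, Nat.prime_three.prime.squarefree⟩
    exact h
  have ir : Irrational (√6) := by exact_mod_cast irr_sqrt 6 (by norm_num) sq6
  have ie : Irrational (√(s:ℝ)) := irr_sqrt s (by omega) hsf
  have ire : Irrational (√6 * √(s:ℝ)) := by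
    rw [← Real.sqrt_mul (by norm_num)]
    exact_mod_cast irr_sqrt (6 * s) (by omega)
      ((Nat.squarefree_mul (Nat.Coprime.symm h6)).2 ⟨sq6, hsf⟩)
  have form : ∀ i, ∃ u v w z : ℤ, x i = (u + v*√6 + w*√(s:ℝ) + z*(√6*√(s:ℝ)))/2 ∧
      u % 2 = w % 2 ∧ v % 2 = z % 2 := by
    intro i
    obtain ⟨hK, hI⟩ := hx i
    obtain ⟨a, b, c, d, hxi⟩ := field_form s (x i) hK
    rw [hxi] at hI
    obtain ⟨u, v, w, z, h1, h2, h3, h4, h5, h6⟩ := int_form _ _ s hr he ir ie ire hs4 hsf h6 a b c d hI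
    refine ⟨u, v, w, z, ?_, h5, h6⟩
    have h1' : (2*a:ℝ) = u := by exact_mod_cast h1
    have h2' : (2*b:ℝ) = v := by exact_mod_cast h2
    have h3' : (2*c:ℝ) = w := by exact_mod_cast h3
    have h4' : (2*d:ℝ) = z := by exact_mod_cast h4
    rw [hxi, ← h1', ← h2', ← h3', ← h4']; ring
  choose u v w z hxf huw hvz using form
  have hsq : ∀ i, 4 * x i ^2 = ((u i^2 + 6 * v i^2 + s * w i^2 + 6 * s * z i^2 : ℤ) : ℝ)
      + 2 * ((u i * v i + s * w i * z i : ℤ) : ℝ) * √6 + 2 * ((u i * w i + 6 * v i * z i : ℤ) : ℝ) * √(s:ℝ)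
      + 2 * ((u i * z i + v i * w i : ℤ):ℝ) * (√6 * √(s:ℝ)) := by
    intro i
    rw [hxf]
    push_cast
    generalize √6 = r at *
    generalize √(s:ℝ) = e at *
    linear_combination (v i^2 + 2 * v i * z i * e + z i^2 * e^2 : ℝ) * hr
      + (w i^2 + 2 * w i * z i * r + 6 * z i^2 : ℝ) * he
  have hS : 4 * ∑ i, x i^2 = ((∑ i, (u i^2 + 6 * v i^2 + s * w i^2 + 6 * s * z i^2) : ℤ) : ℝ)
      + 2 * ((∑ i, (u i * v i + s * w i * z i) : ℤ) : ℝ) * √6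
      + 2 * ((∑ i, (u i * w i + 6 * v i * z i) : ℤ) : ℝ) * √(s:ℝ)
      + 2 * ((∑ i, (u i * z i + v i * w i) : ℤ):ℝ) * (√6 * √(s:ℝ)) := by
    rw [Finset.mul_sum, Finset.sum_congr rfl (fun i _ => hsq i)]
    simp only [Int.cast_sum, Finset.mul_sum, Finset.sum_mul, ← Finset.sum_add_distrib]
  rw [← hsum] at hS
  refine core5 s (by exact_mod_cast hs13) u v w z huw hvz ?_ ?_ ?_ ?_ <;>
  generalize ∑ i, (u i^2 + 6 * v i^2 + s * w i^2 + 6 * s * z i^2) = A at * <;>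
  generalize ∑ i, (u i * v i + s * w i * z i) = B at * <;>
  generalize ∑ i, (u i * w i + 6 * v i * z i) = C at * <;>
  generalize ∑ i, (u i * z i + v i * w i) = D at * <;>
  obtain ⟨k1, k2, k3, k4⟩ := indep _ _ s hr (by exact_mod_cast he) ir ie ire (A - 50 - 2*s) (2*B-8) (2*C-8) (2*D) (by
    push_cast
    generalize √6 = r at *
    generalize √(s:ℝ) = e at *
    linear_combination (-1)*hS + 4*hr + 2 * he)
  · have : (A:ℚ) = 50 + 2*s := by linarith
    exact_mod_cast this
  · have : (B:ℚ) = 4 := by linarith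
    exact_mod_cast this
  · have : (C:ℚ) = 4 := by linarith
    exact_mod_cast this
  · have : (D:ℚ) = 0 := by linarith
    exact_mod_cast this

lemma is_six (s : ℕ) (hs4 : s % 4 = 1) :
    SumOfSquaresLen (ringOfInt 6 (s : ℝ)) 6
        ((1 : ℝ) ^ 2 + 1 ^ 2 + 1 ^ 2 + (1 + Real.sqrt 6) ^ 2
          + ((1 + Real.sqrt s) / 2) ^ 2 + (1 + (1 + Real.sqrt s) / 2) ^ 2) := by
  have m6 : √6 ∈ biquadField 6 (s:ℝ) := IntermediateField.subset_adjoin _ _ (by simp)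
  have ms : √(s:ℝ) ∈ biquadField 6 (s:ℝ) := IntermediateField.subset_adjoin _ _ (by simp)
  have m1 : (1:ℝ) ∈ biquadField 6 (s:ℝ) := one_mem _
  have m2 : (2:ℝ) ∈ biquadField 6 (s:ℝ) := ofNat_mem _ 2
  have i1 : IsIntegral ℤ (1:ℝ) := isIntegral_one
  have i6 : IsIntegral ℤ (√6) := by
    apply IsIntegral.of_pow (n := 2) (by norm_num)
    rw [Real.sq_sqrt (by norm_num)]
    exact_mod_cast isInt_nat (R := ℤ) 6
  have ih : IsIntegral ℤ ((1 + √(s:ℝ))/2) := by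
    obtain ⟨t, rfl⟩ : ∃ t, s = 4*t+1 := ⟨s/4, by omega⟩
    have he : (√((4*t+1:ℕ):ℝ))^2 = (4*t+1:ℕ) := Real.sq_sqrt (by positivity)
    refine ⟨Polynomial.X^2 - Polynomial.X - Polynomial.C (t:ℤ), by monicity!, ?_⟩
    simp only [Polynomial.eval₂_sub, Polynomial.eval₂_pow, Polynomial.eval₂_X, Polynomial.eval₂_C]
    generalize √((4*t+1:ℕ):ℝ) = e at *
    push_cast at he ⊢
    linear_combination he/4
  have mh : (1 + √(s:ℝ))/2 ∈ biquadField 6 (s:ℝ) := div_mem (add_mem m1 ms) m2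
  refine ⟨![1,1,1,1+√6,(1+√(s:ℝ))/2, 1+(1+√(s:ℝ))/2], ?_, ?_⟩
  · intro i
    fin_cases i
    · exact ⟨m1, i1⟩
    · exact ⟨m1, i1⟩
    · exact ⟨m1, i1⟩
    · exact ⟨add_mem m1 m6, i1.add i6⟩
    · exact ⟨mh, ih⟩
    · exact ⟨add_mem m1 mh, i1.add ih⟩
  · simp [Fin.sum_univ_six]

theorem m6_s1_length_six (s : ℕ) (hs4 : s % 4 = 1) (hsf : Squarefree s)
    (hs13 : 13 ≤ s) (h6 : Nat.gcd s 6 = 1) :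
    sqLength (ringOfInt 6 (s : ℝ))
        ((1 : ℝ) ^ 2 + 1 ^ 2 + 1 ^ 2 + (1 + Real.sqrt 6) ^ 2
          + ((1 + Real.sqrt s) / 2) ^ 2 + (1 + (1 + Real.sqrt s) / 2) ^ 2) = 6 ∧
    6 ≤ pythagorasNumber (ringOfInt 6 (s : ℝ)) := by
  have hlen : sqLength (ringOfInt 6 (s : ℝ))
        ((1 : ℝ) ^ 2 + 1 ^ 2 + 1 ^ 2 + (1 + Real.sqrt 6) ^ 2
          + ((1 + Real.sqrt s) / 2) ^ 2 + (1 + (1 + Real.sqrt s) / 2) ^ 2) = 6 := by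
    apply le_antisymm
    · exact sInf_le ⟨6, rfl, is_six s hs4⟩
    · refine le_sInf ?_
      rintro n ⟨k, rfl, hk⟩
      by_contra hlt
      have hk5 : k ≤ 5 := by
        have : ¬ (6 ≤ k) := fun h => hlt (by exact_mod_cast h)
        omega
      refine not_five s hs4 hsf hs13 h6 (sos_mono _ ?_ k 5 hk5 _ hk)
      exact ⟨zero_mem _, isIntegral_zero⟩
  refine ⟨hlen, ?_⟩
  exact le_sSup ⟨_, ⟨6, is_six s hs4⟩, hlen.symm⟩
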